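/- Let T > 0, ω = 2π/T, ω_h > 0, and let y : ℝ → ℝ be continuous and T-periodic. Suppose η : ℝ → ℝ is continuously differentiable, T-periodic, and satisfies η'(t) = ω_h (y(t) − η(t)) for all t. Then ∫₀^T (y(t) − η(t)) sin(ωt) dt = −T · Im( F_H(iω) · c₁(y) ), where F_H(s) = s/(s + ω_h) and c₁(y) = (1/T)∫₀^T y(t) e^{−iωt} dt. -/

import Mathlib

open MeasureTheory

/-- The first Fourier coefficient of a function with period `T`:
`c₁(f) = (1/T) ∫₀^T f(t) e^{-iωt} dt` with `ω = 2π/T`. -/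
noncomputable def fourierC1 (T : ℝ) (f : ℝ → ℂ) : ℂ :=
  (1 / (T : ℂ)) * ∫ t in (0:ℝ)..T, f t * Complex.exp (-(Complex.I * (2 * Real.pi / T : ℝ) * t))

/-- Differentiating a periodic function multiplies its first Fourier coefficient by `iω`. -/
theorem fourierC1_of_hasDerivAt {T : ℝ} {f f' : ℝ → ℂ} (hT : T ≠ 0)
    (hf : ∀ t, HasDerivAt f (f' t) t) (hf' : Continuous f') (hper : Function.Periodic f T) :
    fourierC1 T f' = Complex.I * (2 * Real.pi / T : ℝ) * fourierC1 T f := by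
  unfold fourierC1
  set ω : ℝ := 2 * Real.pi / T with hω
  have hexp (t : ℝ) : HasDerivAt (fun t : ℝ => Complex.exp (-(Complex.I * ω * t)))
      (-(Complex.I * ω) * Complex.exp (-(Complex.I * ω * t))) t := by
    have h := (((Complex.ofRealCLM.hasDerivAt (x := t)).const_mul (Complex.I * ω)).neg).cexp
    simpa [mul_comm] using h
  have hexpT : Complex.exp (-(Complex.I * ω * T)) = 1 := by
    have hωT : -(Complex.I * ω * T) = -(2 * Real.pi * Complex.I) := by
      have hT' : (T : ℂ) ≠ 0 := mod_cast hT
      rw [hω]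
      push_cast
      field_simp
    rw [hωT, Complex.exp_neg, Complex.exp_two_pi_mul_I, inv_one]
  have hparts := intervalIntegral.integral_mul_deriv_eq_deriv_mul
    (a := 0) (b := T) (fun t _ => hf t) (fun t _ => hexp t)
    (hf'.intervalIntegrable _ _)
    ((by fun_prop : Continuous fun t : ℝ =>
      -(Complex.I * ω) * Complex.exp (-(Complex.I * ω * t))).intervalIntegrable _ _)
  have hfT : f T = f 0 := by simpa using hper 0
  simp only [mul_left_comm (f _), intervalIntegral.integral_const_mul, hexpT, hfT,
    Complex.ofReal_zero, mul_zero, neg_zero, Complex.exp_zero, sub_self, zero_sub] at hparts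
  linear_combination (1 / (T : ℂ)) * hparts

theorem fourierC1_sub (T : ℝ) {f g : ℝ → ℂ} (hf : Continuous f) (hg : Continuous g) :
    fourierC1 T (fun t => f t - g t) = fourierC1 T f - fourierC1 T g := by
  simp only [fourierC1, sub_mul]
  rw [intervalIntegral.integral_sub, mul_sub] <;>
    exact Continuous.intervalIntegrable (by fun_prop) _ _

theorem fourierC1_const_mul (T : ℝ) (c : ℂ) (f : ℝ → ℂ) :
    fourierC1 T (fun t => c * f t) = c * fourierC1 T f := by
  simp only [fourierC1, mul_assoc, intervalIntegral.integral_const_mul]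
  ring

/-- Demodulating a real signal by a sine extracts the imaginary part of its first Fourier
coefficient. -/
theorem integral_mul_sin_eq_fourierC1_im {T : ℝ} (hT : T ≠ 0) {f : ℝ → ℝ} (hf : Continuous f) :
    ∫ t in (0:ℝ)..T, f t * Real.sin (2 * Real.pi / T * t) =
      -T * (fourierC1 T (fun t => (f t : ℂ))).im := by
  have him (t : ℝ) :
      Complex.imCLM (f t * Complex.exp (-(Complex.I * (2 * Real.pi / T : ℝ) * t))) =
        -(f t * Real.sin (2 * Real.pi / T * t)) := by
    have harg : -(Complex.I * (2 * Real.pi / T : ℝ) * t) =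
        ((-(2 * Real.pi / T * t) : ℝ) : ℂ) * Complex.I := by
      push_cast
      ring
    rw [harg, Complex.imCLM_apply, Complex.im_ofReal_mul, Complex.exp_ofReal_mul_I_im,
      Real.sin_neg, mul_neg]
  have hint := Complex.imCLM.intervalIntegral_comp_comm (μ := volume) (a := 0) (b := T)
    ((by fun_prop : Continuous fun t : ℝ =>
      (f t : ℂ) * Complex.exp (-(Complex.I * (2 * Real.pi / T : ℝ) * t))).intervalIntegrable _ _)
  simp only [him, intervalIntegral.integral_neg, Complex.imCLM_apply] at hint
  have hscale : (1 / (T : ℂ)) = ((1 / T : ℝ) : ℂ) := by push_cast; rfl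
  rw [fourierC1, hscale, Complex.im_ofReal_mul, ← hint]
  field_simp

/-- High-pass filtering followed by demodulation: if `η' = ω_h(y − η)` with `y, η`
`T`-periodic, then `∫₀^T (y − η) sin(ωt) dt = −T·Im(F_H(iω)·c₁(y))`, where
`F_H(s) = s/(s + ω_h)`. -/
theorem highpass_demodulation (T ω ωh : ℝ) (hT : 0 < T) (hω : ω = 2 * Real.pi / T)
    (hωh : 0 < ωh)
    (y : ℝ → ℝ) (hy : Continuous y) (hyT : Function.Periodic y T)
    (η : ℝ → ℝ) (hη : ContDiff ℝ 1 η) (hηT : Function.Periodic η T)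
    (hηd : ∀ t, deriv η t = ωh * (y t - η t)) :
    ∫ t in (0:ℝ)..T, (y t - η t) * Real.sin (ω * t) =
      -T * ((Complex.I * (ω : ℂ) / (Complex.I * (ω : ℂ) + (ωh : ℂ))) *
        fourierC1 T (fun t => (y t : ℂ))).im := by
  subst hω
  have hηc : Continuous η := hη.continuous
  have hderiv (t : ℝ) : HasDerivAt (fun t => (η t : ℂ)) ((ωh : ℂ) * ((y t : ℂ) - η t)) t := by
    have h := ((hη.differentiable one_ne_zero) t).hasDerivAt.ofReal_comp
    rw [hηd t] at h
    exact_mod_cast h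
  have hcoeff := fourierC1_of_hasDerivAt hT.ne' hderiv (by fun_prop)
    (fun t => by simp only [hηT t])
  have hsub := fourierC1_sub T (f := fun t => (y t : ℂ)) (g := fun t => (η t : ℂ))
    (by fun_prop) (by fun_prop)
  rw [fourierC1_const_mul, hsub] at hcoeff
  have hden : Complex.I * ((2 * Real.pi / T : ℝ) : ℂ) + (ωh : ℂ) ≠ 0 := fun h =>
    hωh.ne' (by simpa using congrArg Complex.re h)
  have hfilter : Complex.I * ((2 * Real.pi / T : ℝ) : ℂ) /
      (Complex.I * ((2 * Real.pi / T : ℝ) : ℂ) + (ωh : ℂ)) * fourierC1 T (fun t => (y t : ℂ)) =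
        fourierC1 T (fun t => ((y t - η t : ℝ) : ℂ)) := by
    simp only [Complex.ofReal_sub]
    rw [hsub, div_mul_eq_mul_div, div_eq_iff hden]
    linear_combination -hcoeff
  rw [hfilter]
  exact integral_mul_sin_eq_fourierC1_im hT.ne' (hy.sub hηc)
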